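/- arXiv:math/0605310 — 4 statements merged into one kernel-verified Lean document; each statement's English description precedes it below -/
import Mathlib

section
/- Let A be a commutative ring and x : Fin k → A a family of elements with (x i)^2 = 0 for every i. Then for every natural number n, (Σ_{i} x i)^n = n! · Σ_{S ⊆ Fin k, |S| = n} Π_{i ∈ S} x i, where the sum is over all subsets S of Fin k of cardinality n. In particular n! divides (Σ_i x i)^n. -/
open Nat Finset

theorem aux_add_pow {A : Type*} [CommRing A] (a y : A) (ha : a ^ 2 = 0) (n : ℕ) :
    (a + y) ^ (n + 1) = y ^ (n + 1) + (n + 1 : A) * a * y ^ n := by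
  induction n with
  | zero => simp [add_comm]
  | succ n ih =>
    rw [pow_succ, ih]
    push_cast
    linear_combination ((n : A) + 1) * y ^ n * ha

theorem aux_finset {A ι : Type*} [CommRing A] (x : ι → A) (hx : ∀ i, x i ^ 2 = 0)
    (s : Finset ι) : ∀ n : ℕ, (∑ i ∈ s, x i) ^ n =
      (n ! : A) * ∑ S ∈ s.powersetCard n, ∏ i ∈ S, x i := by
  classical
  induction s using Finset.induction_on with
  | empty =>
    intro n
    cases n with
    | zero => simp
    | succ n =>
      rw [Finset.powersetCard_eq_empty.2 (by simp)]
      simp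
  | insert a s ha ih =>
    intro n
    cases n with
    | zero => simp
    | succ n =>
      have hmem : ∀ S ∈ s.powersetCard n, a ∉ S := fun S hS h =>
        ha ((Finset.mem_powersetCard.1 hS).1 h)
      have hdisj : Disjoint (s.powersetCard (n + 1)) ((s.powersetCard n).image (insert a)) := by
        rw [Finset.disjoint_left]
        intro S hS hS'
        obtain ⟨T, _, rfl⟩ := Finset.mem_image.1 hS'
        exact ha ((Finset.mem_powersetCard.1 hS).1 (Finset.mem_insert_self a T))
      have hinj : Set.InjOn (insert a) (s.powersetCard n : Set (Finset ι)) := by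
        intro S hS T hT h
        rw [← Finset.erase_insert (hmem S hS), ← Finset.erase_insert (hmem T hT)]
        exact congrArg (fun U => U.erase a) h
      have hprod : ∑ S ∈ s.powersetCard n, ∏ i ∈ insert a S, x i =
          x a * ∑ S ∈ s.powersetCard n, ∏ i ∈ S, x i := by
        rw [Finset.mul_sum]
        exact Finset.sum_congr rfl fun S hS => Finset.prod_insert (hmem S hS)
      rw [Finset.sum_insert ha, aux_add_pow _ _ (hx a), ih, ih,
        Finset.powersetCard_succ_insert ha, Finset.sum_union hdisj, Finset.sum_image hinj, hprod,
        Nat.factorial_succ]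
      push_cast
      ring

/-- If `x 0, …, x (k-1)` are square-zero elements of a commutative ring `A`, then for every `n`
`(Σ i, x i) ^ n = n ! * Σ_{S ⊆ Fin k, |S| = n} Π_{i ∈ S} x i`; in particular `n !` divides
`(Σ i, x i) ^ n`. -/
theorem sum_sq_zero_pow_eq_factorial_mul (A : Type*) [CommRing A] (k : ℕ)
    (x : Fin k → A) (hx : ∀ i, x i ^ 2 = 0) (n : ℕ) :
    ((∑ i, x i) ^ n =
      (n ! : A) * ∑ S ∈ Finset.univ.powersetCard n, ∏ i ∈ S, x i) ∧
    ((n ! : A) ∣ (∑ i, x i) ^ n) := by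
  have h := aux_finset x hx Finset.univ n
  exact ⟨h, Dvd.intro _ h.symm⟩
end

section
/- Let A be a commutative ring and y : Fin m → A a family of elements with (y i)^2 = 0 for every i. For each natural number k set γ_k = Σ_{S ⊆ Fin m, |S| = k} Π_{i ∈ S} y i. Then for all natural numbers i and j, γ_i · γ_j = C(i+j, i) · γ_{i+j}, where C(i+j,i) is the binomial coefficient. -/
theorem esum_insert_aux {A ι : Type*} [CommRing A] [DecidableEq ι] (y : ι → A) (a : ι)
    (s : Finset ι) (ha : a ∉ s) (k : ℕ) :
    ∑ S ∈ (insert a s).powersetCard (k + 1), ∏ i ∈ S, y i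
      = ∑ S ∈ s.powersetCard (k + 1), ∏ i ∈ S, y i
        + y a * ∑ S ∈ s.powersetCard k, ∏ i ∈ S, y i := by
  have hn : ∀ S ∈ s.powersetCard k, a ∉ S := fun S hS h =>
    ha ((Finset.mem_powersetCard.1 hS).1 h)
  rw [Finset.powersetCard_succ_insert ha, Finset.sum_union, Finset.sum_image, Finset.mul_sum]
  · congr 1
    exact Finset.sum_congr rfl fun S hS => Finset.prod_insert (hn S hS)
  · intro S hS T hT h
    rw [← Finset.erase_insert (hn S hS), ← Finset.erase_insert (hn T hT)]
    exact congrArg (fun U => Finset.erase U a) h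
  · rw [Finset.disjoint_left]
    intro S hS hS'
    obtain ⟨T, _, rfl⟩ := Finset.mem_image.1 hS'
    exact ha ((Finset.mem_powersetCard.1 hS).1 (Finset.mem_insert_self a T))

theorem esum_mul_aux {A ι : Type*} [CommRing A] [DecidableEq ι] (y : ι → A)
    (hy : ∀ i, y i ^ 2 = 0) (s : Finset ι) : ∀ i j : ℕ,
    (∑ S ∈ s.powersetCard i, ∏ i ∈ S, y i) * (∑ S ∈ s.powersetCard j, ∏ i ∈ S, y i)
      = ((i + j).choose i : A) * ∑ S ∈ s.powersetCard (i + j), ∏ i ∈ S, y i := by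
  induction s using Finset.induction_on with
  | empty =>
    intro i j
    rcases i with _ | i
    · simp
    · have h : ∀ k, Finset.powersetCard (k + 1) (∅ : Finset ι) = ∅ := fun k =>
        Finset.powersetCard_eq_empty.2 (by simp)
      rw [show i + 1 + j = (i + j) + 1 by omega, h, h]
      simp
  | insert a s ha ih =>
    intro i j
    rcases i with _ | i
    · simp
    rcases j with _ | j
    · simp
    have h1 := ih (i + 1) (j + 1)
    have h2 := ih i (j + 1)
    have h3 := ih (i + 1) j
    have hc : (((i + j + 1) + 1).choose (i + 1) : A)
        = ((i + j + 1).choose i : A) + ((i + j + 1).choose (i + 1) : A) := by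
      rw [Nat.choose_succ_succ]; push_cast; rfl
    rw [show i + 1 + (j + 1) = (i + j + 1) + 1 by omega] at h1 ⊢
    rw [show i + (j + 1) = i + j + 1 by omega] at h2
    rw [show i + 1 + j = i + j + 1 by omega] at h3
    rw [esum_insert_aux y a s ha, esum_insert_aux y a s ha, esum_insert_aux y a s ha]
    rw [hc] at h1 ⊢
    linear_combination h1 + y a * h2 + y a * h3 +
      (∑ S ∈ s.powersetCard i, ∏ i ∈ S, y i) * (∑ S ∈ s.powersetCard j, ∏ i ∈ S, y i) * hy a


/-- If `y 0, …, y (m-1)` are square-zero elements of a commutative ring `A` and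
`γ k = Σ_{S ⊆ Fin m, |S| = k} Π_{i ∈ S} y i`, then `γ i * γ j = C(i+j, i) * γ (i+j)`:
the `γ k` satisfy the multiplication rule of divided powers `w ^ k / k !`. -/
theorem dpow_mul_dpow_of_sq_zero (A : Type*) [CommRing A] (m : ℕ)
    (y : Fin m → A) (hy : ∀ i, y i ^ 2 = 0)
    (γ : ℕ → A)
    (hγ : ∀ k, γ k = ∑ S ∈ Finset.univ.powersetCard k, ∏ i ∈ S, y i)
    (i j : ℕ) :
    γ i * γ j = ((i + j).choose i : A) * γ (i + j) := by
  rw [hγ, hγ, hγ]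
  exact esum_mul_aux y hy Finset.univ i j
end

section
/- Let R be a nontrivial commutative ring, M the free R-module with basis (b_0, …, b_{2n-1}), and Λ = ExteriorAlgebra R M. Set y_i = ι(b_{2i})·ι(b_{2i+1}) ∈ Λ for 0 ≤ i < n and γ_k = Σ_{S ⊆ Fin n, |S| = k} Π_{i ∈ S} y_i. Then the family (γ_0, γ_1, …, γ_n) is linearly independent over R. -/
open ExteriorAlgebra

lemma aux_basis_list {R M I : Type*} [LinearOrder I] [CommRing R] [AddCommGroup M] [Module R M]
    (b : Module.Basis I R M) (l : List I) (hl : l.SortedLT) :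
    (l.map (fun i => ι R (b i))).prod = b.ExteriorAlgebra l.toFinset := by
  have h1 : l.toFinset.sort (· ≤ ·) = l :=
    (List.toFinset_sort (· ≤ ·) hl.nodup).2 hl.sortedLE.pairwise
  rw [ExteriorAlgebra.basis_apply_ofCard b (rfl : l.toFinset.card = _), ιMulti_family,
    ιMulti_apply]
  congr 1
  conv_lhs => rw [← h1, ← Finset.listMap_orderEmbOfFin_finRange l.toFinset rfl]
  rw [List.map_map, List.ofFn_eq_map]
  rfl

lemma aux_lt0 (n : ℕ) (i : Fin n) : 2 * (i : ℕ) < 2 * n := by omega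

lemma aux_lt1 (n : ℕ) (i : Fin n) : 2 * (i : ℕ) + 1 < 2 * n := by omega

def auxPair (n : ℕ) (i : Fin n) : List (Fin (2 * n)) :=
  [⟨2 * (i : ℕ), aux_lt0 n i⟩, ⟨2 * (i : ℕ) + 1, aux_lt1 n i⟩]

lemma aux_sorted (n : ℕ) (l : List (Fin n)) (hl : l.SortedLT) :
    (l.flatMap (auxPair n)).SortedLT := by
  apply List.Pairwise.sortedLT
  rw [List.pairwise_flatMap]
  refine ⟨fun a _ => by simp [auxPair], hl.pairwise.imp ?_⟩
  intro a c hac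
  have : (a : ℕ) < c := hac
  simp only [auxPair, List.mem_cons, List.not_mem_nil, or_false]
  rintro x (rfl | rfl) z (rfl | rfl) <;> simp only [Fin.mk_lt_mk] <;> omega

lemma aux_inj (n : ℕ) : Function.Injective
    (fun S : Finset (Fin n) => ((S.sort (· ≤ ·)).flatMap (auxPair n)).toFinset) := by
  have key : ∀ (S : Finset (Fin n)) (i : Fin n), i ∈ S ↔
      (⟨2 * (i : ℕ), aux_lt0 n i⟩ : Fin (2 * n)) ∈
        ((S.sort (· ≤ ·)).flatMap (auxPair n)).toFinset := by
    intro S i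
    simp only [auxPair, List.mem_toFinset, List.mem_flatMap, Finset.mem_sort, List.mem_cons,
      List.not_mem_nil, or_false, Fin.mk.injEq]
    constructor
    · intro h
      exact ⟨i, h, Or.inl rfl⟩
    · rintro ⟨a, ha, h | h⟩
      · have : i = a := Fin.ext (by omega)
        exact this ▸ ha
      · omega
  intro S T h
  ext i
  rw [key S, key T]
  simp only at h
  rw [h]

/-- In the exterior algebra of a free module with basis `b 0, …, b (2n-1)` over a nontrivial
commutative ring `R`, set `y i = ι (b (2i)) * ι (b (2i+1))` and
`γ k = Σ_{S ⊆ Fin n, |S| = k} Π_{i ∈ S} y i` (the product over `S` taken in increasing order;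
the factors `y i` pairwise commute).  Then `γ 0, γ 1, …, γ n` are linearly independent
over `R`. -/
theorem grassmann_divided_powers_linearIndependent (R : Type*) [CommRing R] [Nontrivial R]
    (n : ℕ)
    (b : Fin (2 * n) → (Fin (2 * n) → R)) (hb : b = fun j => Pi.single j 1)
    (y : Fin n → ExteriorAlgebra R (Fin (2 * n) → R))
    (hy : ∀ i : Fin n,
      y i = ι R (b ⟨2 * (i : ℕ), by omega⟩) * ι R (b ⟨2 * (i : ℕ) + 1, by omega⟩)) :
    LinearIndependent R
      (fun k : Fin (n + 1) =>
        ∑ S ∈ Finset.univ.powersetCard (k : ℕ), ((S.sort (· ≤ ·)).map y).prod) := by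
  have hB : ∀ j, b j = Pi.basisFun R (Fin (2 * n)) j := by
    intro j; rw [hb]; simp
  have hl : ∀ l : List (Fin n), (l.map y).prod =
      ((l.flatMap (auxPair n)).map (fun i => ι R (Pi.basisFun R (Fin (2 * n)) i))).prod := by
    intro l
    induction l with
    | nil => simp
    | cons a l ih =>
      rw [List.map_cons, List.prod_cons, ih, List.flatMap_cons, List.map_append,
        List.prod_append, hy, hB, hB]
      simp only [auxPair, List.map_cons, List.map_nil, List.prod_cons, List.prod_nil, mul_one]
  have hv : LinearIndependent R (fun S : Finset (Fin n) => ((S.sort (· ≤ ·)).map y).prod) := by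
    have h := (Pi.basisFun R (Fin (2 * n))).ExteriorAlgebra.linearIndependent.comp _ (aux_inj n)
    convert h using 1
    funext S
    rw [hl, aux_basis_list _ _ (aux_sorted n _ S.sortedLT_sort)]
    rfl
  rw [Fintype.linearIndependent_iff] at hv ⊢
  intro g hg k
  have hc : ∀ S : Finset (Fin n), S.card < n + 1 := fun S => by
    have := S.card_le_univ
    simp at this
    omega
  have h2 := hv (fun S => g ⟨S.card, hc S⟩) (by
    rw [← hg, ← Finset.sum_fiberwise Finset.univ (fun S : Finset (Fin n) =>
      (⟨S.card, hc S⟩ : Fin (n + 1)))]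
    refine Finset.sum_congr rfl fun k _ => ?_
    rw [Finset.smul_sum]
    refine Finset.sum_congr ?_ ?_
    · ext S
      simp [Finset.mem_powersetCard, Fin.ext_iff]
    · intro S hS
      have : S.card = k := (Finset.mem_powersetCard.1 hS).2
      simp [this])
  obtain ⟨S, -, hS⟩ := Finset.exists_subset_card_eq
    (s := (Finset.univ : Finset (Fin n))) (n := (k : ℕ)) (by simp; omega)
  have := h2 S
  simpa [hS] using this
end

section
/- Let R be a commutative ring and M the free R-module with basis (b_0, …, b_{2n-1}). In Λ = ExteriorAlgebra R M set w = Σ_{i=0}^{n-1} ι(b_{2i})·ι(b_{2i+1}). Then for every natural number k, w^k = k! · Σ_{S ⊆ Fin n, |S| = k} Π_{i ∈ S} ι(b_{2i})·ι(b_{2i+1}); in particular w^k = 0 for k > n, and for k ≤ n the element w^k is divisible by k! in Λ. -/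
open Nat ExteriorAlgebra

theorem gw_add_pow {A : Type*} [Ring A] (a W : A) (h : Commute a W) (ha : a * a = 0) (k : ℕ) :
    (a + W) ^ (k + 1) = W ^ (k + 1) + ((k + 1 : ℕ) : A) * (a * W ^ k) := by
  induction k with
  | zero => simp [add_comm]
  | succ k ih =>
    have h1 : a * W ^ (k + 1) = W ^ (k + 1) * a := (h.pow_right (k + 1)).eq
    have h2 : a * W ^ k * a = 0 := by
      rw [(h.pow_right k).eq, mul_assoc, ha, mul_zero]
    rw [pow_succ, ih, add_mul, mul_add, mul_add, mul_assoc _ _ a, h2, ← h1, ← pow_succ,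
      mul_assoc _ _ W, mul_assoc a _ W, ← pow_succ]
    push_cast
    noncomm_ring

theorem gw_prod_insert {A : Type*} [Ring A] {n : ℕ} (y : Fin n → A)
    (hc : ∀ i j, Commute (y i) (y j)) (a : Fin n) (S : Finset (Fin n)) (ha : a ∉ S) :
    (((insert a S).sort (· ≤ ·)).map y).prod = y a * ((S.sort (· ≤ ·)).map y).prod := by
  have hp : ((insert a S).sort (· ≤ ·)).Perm (a :: S.sort (· ≤ ·)) := by
    rw [← Multiset.coe_eq_coe, ← Multiset.cons_coe, Finset.sort_eq, Finset.sort_eq,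
      Finset.insert_val_of_notMem ha]
  rw [← List.prod_cons, ← List.map_cons]
  refine List.Perm.prod_eq' (hp.map y) ?_
  rw [List.pairwise_map]
  exact List.pairwise_of_forall (fun i j => hc i j)

theorem gw_pow {A : Type*} [Ring A] {n : ℕ} (y : Fin n → A)
    (hc : ∀ i j, Commute (y i) (y j)) (hs : ∀ i, y i * y i = 0) (s : Finset (Fin n)) :
    ∀ k : ℕ, (∑ i ∈ s, y i) ^ k = (k ! : A) *
        ∑ S ∈ s.powersetCard k, ((S.sort (· ≤ ·)).map y).prod := by
  induction s using Finset.induction_on with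
  | empty =>
    intro k
    cases k with
    | zero => simp
    | succ k => rw [Finset.powersetCard_eq_empty.2 (by simp)]; simp
  | insert a s ha ih =>
    intro k
    cases k with
    | zero => simp
    | succ k =>
      rw [Finset.sum_insert ha, gw_add_pow _ _ (Commute.sum_right _ _ _ fun j _ => hc a j) (hs a),
        ih, ih, Finset.powersetCard_succ_insert ha, Finset.sum_union, Finset.sum_image, mul_add]
      · congr 1
        rw [Finset.sum_congr rfl fun S hS => gw_prod_insert y hc a S
          fun h => ha ((Finset.mem_powersetCard.1 hS).1 h), ← Finset.mul_sum, Nat.factorial_succ,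
          Nat.cast_mul, mul_assoc, ← mul_assoc (y a), ← (Nat.cast_commute (k !) (y a)).eq,
          mul_assoc]
      · intro S hS T hT hST
        have h1 : a ∉ S := fun h => ha ((Finset.mem_powersetCard.1 hS).1 h)
        have h2 : a ∉ T := fun h => ha ((Finset.mem_powersetCard.1 hT).1 h)
        rw [← Finset.erase_insert h1, ← Finset.erase_insert h2]
        exact congrArg (fun U => Finset.erase U a) hST
      · rw [Finset.disjoint_left]
        intro S hS hS'
        obtain ⟨T, _, rfl⟩ := Finset.mem_image.1 hS'
        exact ha ((Finset.mem_powersetCard.1 hS).1 (Finset.mem_insert_self a T))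

theorem gw_comm {R M : Type*} [CommRing R] [AddCommGroup M] [Module R M] (p q r : M) :
    Commute (ι R p * ι R q) (ι R r) := by
  have h1 := eq_neg_of_add_eq_zero_left (ι_add_mul_swap (R := R) q r)
  have h2 := eq_neg_of_add_eq_zero_left (ι_add_mul_swap (R := R) p r)
  rw [Commute, SemiconjBy, mul_assoc, h1, mul_neg, ← mul_assoc, h2, neg_mul, neg_neg, mul_assoc]

/-- In the exterior algebra of a free module with basis `b 0, …, b (2n-1)` over a commutative
ring `R`, let `w = Σ_{i<n} ι (b (2i)) * ι (b (2i+1))`.  Then for every `k`,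
`w ^ k = k ! * Σ_{S ⊆ Fin n, |S| = k} Π_{i ∈ S} ι (b (2i)) * ι (b (2i+1))` (products over `S`
taken in increasing order); in particular `w ^ k = 0` for `k > n`, and for `k ≤ n` the
element `w ^ k` is divisible by `k !`. -/
theorem grassmann_w_pow_eq_factorial_mul (R : Type*) [CommRing R] (n : ℕ)
    (b : Fin (2 * n) → (Fin (2 * n) → R)) (hb : b = fun j => Pi.single j 1)
    (y : Fin n → ExteriorAlgebra R (Fin (2 * n) → R))
    (hy : ∀ i : Fin n,
      y i = ι R (b ⟨2 * (i : ℕ), by omega⟩) * ι R (b ⟨2 * (i : ℕ) + 1, by omega⟩))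
    (w : ExteriorAlgebra R (Fin (2 * n) → R)) (hw : w = ∑ i, y i) :
    (∀ k : ℕ,
      w ^ k = (k ! : ExteriorAlgebra R (Fin (2 * n) → R)) *
        ∑ S ∈ Finset.univ.powersetCard k, ((S.sort (· ≤ ·)).map y).prod) ∧
    (∀ k : ℕ, n < k → w ^ k = 0) ∧
    (∀ k : ℕ, k ≤ n → (k ! : ExteriorAlgebra R (Fin (2 * n) → R)) ∣ w ^ k) := by
  have hc : ∀ i j, Commute (y i) (y j) := fun i j => by
    rw [hy i, hy j]
    exact (gw_comm _ _ _).mul_right (gw_comm _ _ _)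
  have hs : ∀ i, y i * y i = 0 := fun i => by
    rw [hy i, ← mul_assoc, (gw_comm _ _ _).eq, ← mul_assoc, ι_sq_zero, zero_mul, zero_mul]
  have key := gw_pow y hc hs Finset.univ
  rw [← hw] at key
  refine ⟨key, fun k hk => ?_, fun k _ => ⟨_, key k⟩⟩
  rw [key k, Finset.powersetCard_eq_empty.2 (by simpa using hk), Finset.sum_empty, mul_zero]
end
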